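/- Under the adapted cuspidal-edge setting, along the u-axis one has L̃_v = −κ_s·Ñ·|f_u|³/|f_u×h|, i.e. the v-derivative of L̃ = −⟨f_u,ν_u⟩ at every point (u₀,0) equals −κ_s(u₀)Ñ(u₀,0)|f_u(u₀,0)|³/|(f_u×h)(u₀,0)|. -/

import Mathlib

noncomputable section

local notation "⟪" x ", " y "⟫" => @inner ℝ _ _ x y

/-- Euclidean 3-space. -/
abbrev E3 : Type := EuclideanSpace ℝ (Fin 3)

/-- The vector in `E3` with coordinates `(a, b, c)`. -/
def e3 (a b c : ℝ) : E3 := (WithLp.equiv 2 (Fin 3 → ℝ)).symm ![a, b, c]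

/-- Cross product on `E3`. -/
def cross3 (a b : E3) : E3 :=
  e3 (a 1 * b 2 - a 2 * b 1) (a 2 * b 0 - a 0 * b 2) (a 0 * b 1 - a 1 * b 0)

/-- Scalar triple product `det(a,b,c)`. -/
def det3 (a b c : E3) : ℝ := ⟪a, cross3 b c⟫

/-- Partial derivative in the `u`-direction. -/
def pu {E : Type*} [NormedAddCommGroup E] [NormedSpace ℝ E] (g : ℝ × ℝ → E) (p : ℝ × ℝ) : E :=
  fderiv ℝ g p (1, 0)

/-- Partial derivative in the `v`-direction. -/
def pv {E : Type*} [NormedAddCommGroup E] [NormedSpace ℝ E] (g : ℝ × ℝ → E) (p : ℝ × ℝ) : E :=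
  fderiv ℝ g p (0, 1)

/-- Signed area density `λ = det(f_u, f_v, ν)`. -/
def lam (f ν : ℝ × ℝ → E3) (p : ℝ × ℝ) : ℝ := det3 (pu f p) (pv f p) (ν p)


/-- `Ẽ = |f_u|²`. -/
def Etil (f : ℝ × ℝ → E3) (p : ℝ × ℝ) : ℝ := ‖pu f p‖ ^ 2

/-- `F̃ = ⟨f_u, h⟩`. -/
def Ftil (f h : ℝ × ℝ → E3) (p : ℝ × ℝ) : ℝ := ⟪pu f p, h p⟫

/-- `G̃ = |h|²`. -/
def Gtil (h : ℝ × ℝ → E3) (p : ℝ × ℝ) : ℝ := ‖h p‖ ^ 2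

/-- `L̃ = −⟨f_u, ν_u⟩`. -/
def Ltil (f ν : ℝ × ℝ → E3) (p : ℝ × ℝ) : ℝ := -⟪pu f p, pu ν p⟫

/-- `M̃ = −⟨h, ν_u⟩`. -/
def Mtil (ν h : ℝ × ℝ → E3) (p : ℝ × ℝ) : ℝ := -⟪h p, pu ν p⟫

/-- `Ñ = −⟨h, ν_v⟩`. -/
def Ntil (ν h : ℝ × ℝ → E3) (p : ℝ × ℝ) : ℝ := -⟪h p, pv ν p⟫

/-- `Ã = ẼÑ − 2vF̃M̃ + vG̃L̃`. -/
def Atil (f ν h : ℝ × ℝ → E3) (p : ℝ × ℝ) : ℝ :=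
  Etil f p * Ntil ν h p - 2 * p.2 * Ftil f h p * Mtil ν h p + p.2 * Gtil h p * Ltil f ν p

/-- `B̃ = √(Ã² − 4v(ẼG̃−F̃²)(L̃Ñ−vM̃²))`. -/
def Btil (f ν h : ℝ × ℝ → E3) (p : ℝ × ℝ) : ℝ :=
  Real.sqrt ((Atil f ν h p) ^ 2 -
    4 * p.2 * (Etil f p * Gtil h p - (Ftil f h p) ^ 2) *
      (Ltil f ν p * Ntil ν h p - p.2 * (Mtil ν h p) ^ 2))

/-- The bounded principal curvature `κ = 2(L̃Ñ−vM̃²)/(Ã+B̃)`. -/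
def kap (f ν h : ℝ × ℝ → E3) (p : ℝ × ℝ) : ℝ :=
  2 * (Ltil f ν p * Ntil ν h p - p.2 * (Mtil ν h p) ^ 2) / (Atil f ν h p + Btil f ν h p)

/-- `κ̂ = (Ã+B̃)/(2|f_u×h|)`, the smooth extension of `λ·κ₁`. -/
def kaphat (f ν h : ℝ × ℝ → E3) (p : ℝ × ℝ) : ℝ :=
  (Atil f ν h p + Btil f ν h p) / (2 * ‖cross3 (pu f p) (h p)‖)

/-- Singular curvature `κ_s` along the u-axis. -/
def kappas (f ν : ℝ × ℝ → E3) (u : ℝ) : ℝ :=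
  det3 (pu f (u, 0)) (pu (pu f) (u, 0)) (ν (u, 0)) / ‖pu f (u, 0)‖ ^ 3

/-- Cuspidal curvature `κ_c` along the u-axis. -/
def kappac (f ν h : ℝ × ℝ → E3) (u : ℝ) : ℝ :=
  2 * Etil f (u, 0) ^ ((3 : ℝ) / 4) * Ntil ν h (u, 0) /
    (Etil f (u, 0) * Gtil h (u, 0) - (Ftil f h (u, 0)) ^ 2) ^ ((3 : ℝ) / 4)

/-- Cusp-directional torsion `κ_t` along the u-axis. -/
def kappat (f ν h : ℝ × ℝ → E3) (u : ℝ) : ℝ :=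
  (Etil f (u, 0) * Mtil ν h (u, 0) - Ftil f h (u, 0) * Ltil f ν (u, 0)) /
    (Etil f (u, 0) * Real.sqrt (Etil f (u, 0) * Gtil h (u, 0) - (Ftil f h (u, 0)) ^ 2))

/-- The focal surface `ŴFC_f = f + (λ/κ̂)ν`. -/
def FChat (f ν h : ℝ × ℝ → E3) (p : ℝ × ℝ) : E3 :=
  f p + (lam f ν p / kaphat f ν h p) • ν p

/-- Coefficient `E` of the first fundamental form of a surface `W`. -/
def surfE (W : ℝ × ℝ → E3) (p : ℝ × ℝ) : ℝ := ‖pu W p‖ ^ 2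

/-- Coefficient `F` of the first fundamental form of a surface `W`. -/
def surfF (W : ℝ × ℝ → E3) (p : ℝ × ℝ) : ℝ := ⟪pu W p, pv W p⟫

/-- Coefficient `G` of the first fundamental form of a surface `W`. -/
def surfG (W : ℝ × ℝ → E3) (p : ℝ × ℝ) : ℝ := ‖pv W p‖ ^ 2

/-- Unit normal `n = (W_u × W_v)/|W_u × W_v|` of a surface `W`. -/
def surfn (W : ℝ × ℝ → E3) (p : ℝ × ℝ) : E3 :=
  ‖cross3 (pu W p) (pv W p)‖⁻¹ • cross3 (pu W p) (pv W p)

/-- Coefficient `L = ⟨W_uu, n⟩` of the second fundamental form. -/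
def surfL (W : ℝ × ℝ → E3) (p : ℝ × ℝ) : ℝ := ⟪pu (pu W) p, surfn W p⟫

/-- Coefficient `M = ⟨W_uv, n⟩` of the second fundamental form. -/
def surfM (W : ℝ × ℝ → E3) (p : ℝ × ℝ) : ℝ := ⟪pv (pu W) p, surfn W p⟫

/-- Coefficient `N = ⟨W_vv, n⟩` of the second fundamental form. -/
def surfN (W : ℝ × ℝ → E3) (p : ℝ × ℝ) : ℝ := ⟪pv (pv W) p, surfn W p⟫

/-- Gaussian curvature of a surface `W`. -/
def gaussK (W : ℝ × ℝ → E3) (p : ℝ × ℝ) : ℝ :=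
  (surfL W p * surfN W p - (surfM W p) ^ 2) /
    (surfE W p * surfG W p - (surfF W p) ^ 2)

/-- Mean curvature of a surface `W` (w.r.t. the unit normal `surfn W`). -/
def meanH (W : ℝ × ℝ → E3) (p : ℝ × ℝ) : ℝ :=
  (surfE W p * surfN W p - 2 * surfF W p * surfM W p + surfG W p * surfL W p) /
    (2 * (surfE W p * surfG W p - (surfF W p) ^ 2))


lemma inner_eq_sum_three (a b : E3) : ⟪a, b⟫ = a 0 * b 0 + a 1 * b 1 + a 2 * b 2 := by
  simp only [PiLp.inner_apply, Fin.sum_univ_three, RCLike.inner_apply, conj_trivial]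
  ring

lemma inner_cross3 (a b c : E3) : ⟪a, cross3 b c⟫ =
    a 0 * (b 1 * c 2 - b 2 * c 1) + a 1 * (b 2 * c 0 - b 0 * c 2)
      + a 2 * (b 0 * c 1 - b 1 * c 0) := by
  simp [inner_eq_sum_three, cross3, e3]

/-- A vector `w` orthogonal to `a` and `n` is proportional to `n × a`. -/
lemma inner_mul_det3_of_orthogonal (a b h n w : E3) (ha : ⟪a, w⟫ = 0) (hn : ⟪n, w⟫ = 0) :
    ⟪b, w⟫ * ⟪n, cross3 a h⟫ = ⟪h, w⟫ * det3 a b n := by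
  simp only [inner_eq_sum_three] at ha hn
  simp only [det3, inner_cross3]
  simp only [inner_eq_sum_three]
  linear_combination
    (b 0 * (h 1 * n 2 - h 2 * n 1) + b 1 * (h 2 * n 0 - h 0 * n 2)
      + b 2 * (h 0 * n 1 - h 1 * n 0)) * ha +
    (b 0 * (a 1 * h 2 - a 2 * h 1) + b 1 * (a 2 * h 0 - a 0 * h 2)
      + b 2 * (a 0 * h 1 - a 1 * h 0)) * hn

section PartialDerivatives

variable {E : Type*} [NormedAddCommGroup E] [NormedSpace ℝ E] {U : Set (ℝ × ℝ)}
  {g : ℝ × ℝ → E} {p : ℝ × ℝ}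

lemma contDiffOn_pu (hU : IsOpen U) (hg : ContDiffOn ℝ (⊤ : ℕ∞) g U) :
    ContDiffOn ℝ (⊤ : ℕ∞) (pu g) U :=
  (hg.fderiv_of_isOpen hU (by simp)).clm_apply contDiffOn_const

lemma contDiffOn_pv (hU : IsOpen U) (hg : ContDiffOn ℝ (⊤ : ℕ∞) g U) :
    ContDiffOn ℝ (⊤ : ℕ∞) (pv g) U :=
  (hg.fderiv_of_isOpen hU (by simp)).clm_apply contDiffOn_const

lemma differentiableAt_of_contDiffOn_isOpen (hU : IsOpen U) (hg : ContDiffOn ℝ (⊤ : ℕ∞) g U)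
    (hp : p ∈ U) : DifferentiableAt ℝ g p :=
  (hg.contDiffAt (hU.mem_nhds hp)).differentiableAt (by simp)

/-- Partial derivatives of a smooth map commute. -/
lemma pv_pu_comm (hU : IsOpen U) (hg : ContDiffOn ℝ (⊤ : ℕ∞) g U) (hp : p ∈ U) :
    pv (pu g) p = pu (pv g) p := by
  have hd : DifferentiableAt ℝ (fderiv ℝ g) p :=
    differentiableAt_of_contDiffOn_isOpen hU (hg.fderiv_of_isOpen hU (by simp)) hp
  have hsymm : IsSymmSndFDerivAt ℝ g p :=
    (hg.contDiffAt (hU.mem_nhds hp)).isSymmSndFDerivAt (by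
      simp only [minSmoothness_of_isRCLikeNormedField]
      exact WithTop.coe_le_coe.2 (le_top : (2 : ℕ∞) ≤ ⊤))
  have key (x y : ℝ × ℝ) :
      fderiv ℝ (fun q => fderiv ℝ g q x) p y = fderiv ℝ (fderiv ℝ g) p y x := by
    rw [fderiv_clm_apply hd (differentiableAt_const x)]
    simp
  change fderiv ℝ (fun q => fderiv ℝ g q (1, 0)) p (0, 1) =
    fderiv ℝ (fun q => fderiv ℝ g q (0, 1)) p (1, 0)
  rw [key, key, hsymm.eq]

lemma fderiv_congr_of_isOpen {g' : ℝ × ℝ → E} (hU : IsOpen U) (hp : p ∈ U)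
    (hgg' : ∀ q ∈ U, g q = g' q) : fderiv ℝ g p = fderiv ℝ g' p :=
  Filter.EventuallyEq.fderiv_eq (Filter.eventually_of_mem (hU.mem_nhds hp) hgg')

lemma pu_snd_smul (hg : DifferentiableAt ℝ g p) :
    pu (fun q => q.2 • g q) p = p.2 • pu g p := by
  simp [pu, fderiv_fun_smul differentiableAt_snd hg, fderiv_snd]

end PartialDerivatives

lemma pu_inner {a b : ℝ × ℝ → E3} {p : ℝ × ℝ} (ha : DifferentiableAt ℝ a p)
    (hb : DifferentiableAt ℝ b p) :
    pu (fun q => ⟪a q, b q⟫) p = ⟪a p, pu b p⟫ + ⟪pu a p, b p⟫ :=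
  fderiv_inner_apply ℝ ha hb (1, 0)

lemma pv_inner {a b : ℝ × ℝ → E3} {p : ℝ × ℝ} (ha : DifferentiableAt ℝ a p)
    (hb : DifferentiableAt ℝ b p) :
    pv (fun q => ⟪a q, b q⟫) p = ⟪a p, pv b p⟫ + ⟪pv a p, b p⟫ :=
  fderiv_inner_apply ℝ ha hb (0, 1)

/-- along the u-axis, `L̃_v = −κ_s·Ñ·|f_u|³/|f_u×h|`. -/
theorem stmt2
    (U : Set (ℝ × ℝ)) (hU : IsOpen U)
    (f ν h : ℝ × ℝ → E3)
    (hf : ContDiffOn ℝ (⊤ : ℕ∞) f U) (hν : ContDiffOn ℝ (⊤ : ℕ∞) ν U) (hhsm : ContDiffOn ℝ (⊤ : ℕ∞) h U)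
    (hax : ∃ p ∈ U, p.2 = (0 : ℝ))
    (hν1 : ∀ p ∈ U, ‖ν p‖ = 1)
    (ho1 : ∀ p ∈ U, (⟪pu f p, ν p⟫ : ℝ) = 0)
    (ho2 : ∀ p ∈ U, (⟪pv f p, ν p⟫ : ℝ) = 0)
    (hfront : ∀ p ∈ U, Function.Injective ⇑(fderiv ℝ (fun q => (f q, ν q)) p))
    (hlam : ∀ p ∈ U, (lam f ν p = 0 ↔ p.2 = 0))
    (hh0 : ∀ p ∈ U, h p ≠ 0)
    (hfv : ∀ p ∈ U, pv f p = p.2 • h p)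
    (hνdef : ∀ p ∈ U, ν p = ‖cross3 (pu f p) (h p)‖⁻¹ • cross3 (pu f p) (h p))
    (hNpos : ∀ p ∈ U, p.2 = 0 → 0 < Ntil ν h p)
    (u₀ : ℝ) (hp : ((u₀, 0) : ℝ × ℝ) ∈ U) :
    pv (Ltil f ν) (u₀, 0) =
      -(kappas f ν u₀ * Ntil ν h (u₀, 0) * ‖pu f (u₀, 0)‖ ^ 3 /
        ‖cross3 (pu f (u₀, 0)) (h (u₀, 0))‖) := by
  have hfu := contDiffOn_pu hU hf
  have hνu := contDiffOn_pu hU hν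
  have hνv := contDiffOn_pv hU hν
  have hhu := contDiffOn_pu hU hhsm
  have dfu {p} (hp : p ∈ U) := differentiableAt_of_contDiffOn_isOpen hU hfu hp
  have dν {p} (hp : p ∈ U) := differentiableAt_of_contDiffOn_isOpen hU hν hp
  have dνu {p} (hp : p ∈ U) := differentiableAt_of_contDiffOn_isOpen hU hνu hp
  have dνv {p} (hp : p ∈ U) := differentiableAt_of_contDiffOn_isOpen hU hνv hp
  have dh {p} (hp : p ∈ U) := differentiableAt_of_contDiffOn_isOpen hU hhsm hp
  have dhu {p} (hp : p ∈ U) := differentiableAt_of_contDiffOn_isOpen hU hhu hp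
  have hfuv : ∀ p ∈ U, pv (pu f) p = p.2 • pu h p := by
    intro p hp
    rw [pv_pu_comm hU hf hp, ← pu_snd_smul (dh hp), pu, pu, fderiv_congr_of_isOpen hU hp hfv]
  have hfuνv : ∀ p ∈ U, ⟪pu f p, pv ν p⟫ = p.2 • -⟪pu h p, ν p⟫ := by
    intro p hp
    have h1 := pv_inner (dfu hp) (dν hp)
    rw [pv, fderiv_congr_of_isOpen hU hp ho1, hfuv p hp, real_inner_smul_left] at h1
    simp only [fderiv_fun_const, Pi.zero_apply, zero_apply] at h1
    rw [smul_eq_mul]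
    linarith
  have hfuu : ⟪pu f (u₀, 0), pu (pv ν) (u₀, 0)⟫ + ⟪pu (pu f) (u₀, 0), pv ν (u₀, 0)⟫ = 0 := by
    rw [← pu_inner (dfu hp) (dνv hp), pu, fderiv_congr_of_isOpen hU hp hfuνv]
    change pu (fun q => q.2 • -⟪pu h q, ν q⟫) (u₀, 0) = 0
    rw [pu_snd_smul (g := fun q => -⟪pu h q, ν q⟫) ((dhu hp).inner ℝ (dν hp)).neg, zero_smul]
  have hL : pv (Ltil f ν) (u₀, 0) = ⟪pu (pu f) (u₀, 0), pv ν (u₀, 0)⟫ := by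
    have h1 : pv (Ltil f ν) (u₀, 0) = -pv (fun q => ⟪pu f q, pu ν q⟫) (u₀, 0) := by
      change fderiv ℝ (fun q => -⟪pu f q, pu ν q⟫) (u₀, 0) (0, 1) = _
      rw [fderiv_fun_neg]
      rfl
    rw [h1, pv_inner (dfu hp) (dνu hp), hfuv _ hp, pv_pu_comm hU hν hp, zero_smul,
      inner_zero_left]
    linarith
  have hννv : ⟪ν (u₀, 0), pv ν (u₀, 0)⟫ = 0 := by
    have h1 := pv_inner (dν hp) (dν hp)
    rw [pv, fderiv_congr_of_isOpen (g' := fun _ => (1 : ℝ)) hU hp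
      (fun q hq => by rw [real_inner_self_eq_norm_sq, hν1 q hq, one_pow]),
      real_inner_comm (ν (u₀, 0))] at h1
    simp only [fderiv_fun_const, Pi.zero_apply, zero_apply] at h1
    linarith
  have hfuνv₀ : ⟪pu f (u₀, 0), pv ν (u₀, 0)⟫ = 0 := by
    rw [hfuνv _ hp, zero_smul]
  have hr : ‖cross3 (pu f (u₀, 0)) (h (u₀, 0))‖ ≠ 0 := by
    intro h0
    have h1 := hν1 _ hp
    rw [hνdef _ hp, h0] at h1
    simp at h1
  have hνcross : ⟪ν (u₀, 0), cross3 (pu f (u₀, 0)) (h (u₀, 0))⟫ =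
      ‖cross3 (pu f (u₀, 0)) (h (u₀, 0))‖ := by
    rw [hνdef _ hp, real_inner_smul_left, real_inner_self_eq_norm_sq]
    field_simp
  have ha : ‖pu f (u₀, 0)‖ ≠ 0 := by
    intro h0
    apply hr
    rw [norm_eq_zero] at h0 ⊢
    rw [h0, ← inner_self_eq_zero (𝕜 := ℝ), inner_cross3]
    simp
  have key := inner_mul_det3_of_orthogonal (pu f (u₀, 0)) (pu (pu f) (u₀, 0)) (h (u₀, 0))
    (ν (u₀, 0)) (pv ν (u₀, 0)) hfuνv₀ hννv
  rw [hνcross] at key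
  rw [hL, kappas, Ntil]
  field_simp
  linear_combination key
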